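/- Let K = [a₁,a₂] × [b₁,b₂] ⊂ (0,∞)² be a compact rectangle. There exists a constant C = C(K) > 0 such that for all ρ = (α,β) ∈ K, ρ₀ = (α₀,β₀) ∈ K, all h ∈ (0,1], and all x > 0, | c(x;ρ₀,h)/c(x;ρ,h) - 1 | ≤ C h (1 + x^{-1}), where c(x;(α,β),h) = (1/β)(1 - e^{-βh})( e^{-βh} x + (α/(2β))(1 - e^{-βh}) ). -/

import Mathlib

/-- Two-sided control of the `γ`-free one-step conditional variance of the CIR process: it is
`h * x` up to a relative error of order `h * (1 + x⁻¹)`, and bounded below by a multiple of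
`h * x`. -/
theorem cir_variance_bounds {A B α β h x : ℝ} (hα : 0 < α) (hαA : α ≤ A) (hβ : 0 < β)
    (hβB : β ≤ B) (hh : 0 < h) (hh1 : h ≤ 1) (hx : 0 < x) :
    |(1 / β) * (1 - Real.exp (-β * h)) *
        (Real.exp (-β * h) * x + α / (2 * β) * (1 - Real.exp (-β * h))) - h * x| ≤
      h * (h * (2 * B * x + A / 2)) ∧
    h * (Real.exp (-B) ^ 2 * x) ≤ (1 / β) * (1 - Real.exp (-β * h)) *
        (Real.exp (-β * h) * x + α / (2 * β) * (1 - Real.exp (-β * h))) := by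
  set e := Real.exp (-β * h) with he
  have hB : 0 < B := hβ.trans_le hβB
  have he_pos : 0 < e := Real.exp_pos _
  have hm_pos : 0 < Real.exp (-B) := Real.exp_pos _
  have hβh : β * h ≤ B * h := mul_le_mul_of_nonneg_right hβB hh.le
  have hβhB : β * h ≤ B := by nlinarith
  have hme : Real.exp (-B) ≤ e := Real.exp_le_exp.mpr (by linarith)
  have he_lower : 1 - β * h ≤ e := by
    have := Real.add_one_le_exp (-β * h)
    linarith
  have he_upper : e * (β * h + 1) ≤ 1 := by
    have h1 : e * Real.exp (β * h) = 1 := by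
      rw [he, ← Real.exp_add]
      simp
    calc e * (β * h + 1) ≤ e * Real.exp (β * h) :=
          mul_le_mul_of_nonneg_left (Real.add_one_le_exp _) he_pos.le
      _ = 1 := h1
  have he_one : e ≤ 1 := by nlinarith [mul_pos he_pos (mul_pos hβ hh)]
  obtain ⟨p, hp⟩ : ∃ p, p = (1 - e) / (β * h) := ⟨_, rfl⟩
  have hp_le : p ≤ 1 := by
    rw [hp, div_le_one (by positivity)]
    linarith
  have hep : e ≤ p := by
    rw [hp, le_div_iff₀ (by positivity)]
    linarith
  have hc : (1 / β) * (1 - e) * (e * x + α / (2 * β) * (1 - e)) =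
      h * (p * e * x + α / 2 * h * p ^ 2) := by
    rw [hp]
    field_simp
  have hp_pos : 0 < p := he_pos.trans_le hep
  have hpe_le : p * e ≤ 1 := mul_le_one₀ hp_le he_pos.le he_one
  have hpe_ge : 1 - 2 * B * h ≤ p * e := by
    nlinarith [mul_nonneg (sub_nonneg.mpr hp_le) (sub_nonneg.mpr he_one)]
  have hpe_ge' : Real.exp (-B) ^ 2 ≤ p * e := by
    rw [sq]
    exact mul_le_mul (hme.trans hep) hme hm_pos.le hp_pos.le
  have hr_nonneg : 0 ≤ α / 2 * h * p ^ 2 := by positivity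
  have hr_le : α / 2 * h * p ^ 2 ≤ A / 2 * h := by
    have : p ^ 2 ≤ 1 := pow_le_one₀ hp_pos.le hp_le
    calc α / 2 * h * p ^ 2 ≤ α / 2 * h * 1 := by gcongr
      _ ≤ A / 2 * h := by rw [mul_one]; gcongr
  have hpex_le := mul_le_mul_of_nonneg_right hpe_le hx.le
  have hpex_ge := mul_le_mul_of_nonneg_right hpe_ge hx.le
  have hBhx : 0 < 2 * B * h * x := by positivity
  have hAh : 0 < A / 2 * h := by have := hα.trans_le hαA; positivity
  rw [hc]
  constructor
  · rw [← mul_sub, abs_mul, abs_of_pos hh]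
    refine mul_le_mul_of_nonneg_left (abs_le.mpr ⟨?_, ?_⟩) hh.le <;> linarith
  · refine mul_le_mul_of_nonneg_left ?_ hh.le
    have := mul_le_mul_of_nonneg_right hpe_ge' hx.le
    linarith

/-- uniform bound on the conditional-variance ratio of the CIR process:
on a compact rectangle `K = [a₁,a₂] × [b₁,b₂] ⊂ (0,∞)²` there is `C > 0` such that for
all `ρ = (α,β), ρ₀ = (α₀,β₀) ∈ K`, all `h ∈ (0,1]`, and all `x > 0`,
`|c(x;ρ₀,h)/c(x;ρ,h) - 1| ≤ C h (1 + x⁻¹)`, where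
`c(x;(α,β),h) = (1/β)(1 - e^{-βh})(e^{-βh}x + (α/(2β))(1 - e^{-βh}))`. -/
theorem stmt_18 (a₁ a₂ b₁ b₂ : ℝ) (ha₁ : 0 < a₁) (ha : a₁ ≤ a₂)
    (hb₁ : 0 < b₁) (hb : b₁ ≤ b₂) :
    let c : ℝ → ℝ → ℝ → ℝ → ℝ := fun x α β h =>
      (1 / β) * (1 - Real.exp (-β * h)) *
        (Real.exp (-β * h) * x + α / (2 * β) * (1 - Real.exp (-β * h)))
    ∃ C > 0, ∀ α β α₀ β₀ : ℝ,
      α ∈ Set.Icc a₁ a₂ → β ∈ Set.Icc b₁ b₂ →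
      α₀ ∈ Set.Icc a₁ a₂ → β₀ ∈ Set.Icc b₁ b₂ →
      ∀ h ∈ Set.Ioc (0 : ℝ) 1, ∀ x : ℝ, 0 < x →
        |c x α₀ β₀ h / c x α β h - 1| ≤ C * h * (1 + x⁻¹) := by
  intro c
  have ha₂ : 0 < a₂ := ha₁.trans_le ha
  have hb₂ : 0 < b₂ := hb₁.trans_le hb
  refine ⟨(4 * b₂ + a₂) / Real.exp (-b₂) ^ 2, by positivity, ?_⟩
  intro α β α₀ β₀ hα hβ hα₀ hβ₀ h hh x hx
  obtain ⟨hc, hc_lower⟩ := cir_variance_bounds (ha₁.trans_le hα.1) hα.2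
    (hb₁.trans_le hβ.1) hβ.2 hh.1 hh.2 hx
  obtain ⟨hc₀, -⟩ := cir_variance_bounds (ha₁.trans_le hα₀.1) hα₀.2
    (hb₁.trans_le hβ₀.1) hβ₀.2 hh.1 hh.2 hx
  change |c x α β h - h * x| ≤ _ at hc
  change _ ≤ c x α β h at hc_lower
  change |c x α₀ β₀ h - h * x| ≤ _ at hc₀
  generalize c x α β h = v at *
  generalize c x α₀ β₀ h = v₀ at *
  have hh0 : 0 < h := hh.1
  have hv : 0 < v := lt_of_lt_of_le (by positivity) hc_lower
  have hdiff : |v₀ - v| ≤ h * (h * (4 * b₂ * x + a₂)) := by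
    have := abs_sub_le v₀ (h * x) v
    rw [abs_sub_comm (h * x) v] at this
    linarith
  rw [div_sub_one hv.ne', abs_div, abs_of_pos hv, div_le_iff₀ hv]
  have hC : 0 ≤ (4 * b₂ + a₂) / Real.exp (-b₂) ^ 2 * h * (1 + x⁻¹) := by positivity
  calc |v₀ - v| ≤ h * (h * (4 * b₂ * x + a₂)) := hdiff
    _ ≤ h * (h * ((4 * b₂ + a₂) * (x + 1))) := by
      gcongr
      nlinarith [mul_pos ha₂ hx]
    _ = (4 * b₂ + a₂) / Real.exp (-b₂) ^ 2 * h * (1 + x⁻¹) *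
        (h * (Real.exp (-b₂) ^ 2 * x)) := by
      field_simp
    _ ≤ _ := mul_le_mul_of_nonneg_left hc_lower hC
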